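/- The function R(z) = (z/e)^z √(2πz) / Γ(z+1) is strictly increasing on (0, ∞). -/

import Mathlib

open MeasureTheory Set Filter

noncomputable def stirlingRatio (z : ℝ) : ℝ :=
  (z / Real.exp 1) ^ z * Real.sqrt (2 * Real.pi * z) / Real.Gamma (z + 1)

lemma hasSum_add_half_mul_log {z : ℝ} (hz : 0 < z) :
    HasSum (fun k : ℕ => 1 / (2 * k + 1) * (1 / (2 * z + 1)) ^ (2 * k))
      ((z + 1 / 2) * (Real.log (z + 1) - Real.log z)) := by
  have h := (Real.hasSum_log_one_add_inv hz).mul_left (z + 1 / 2)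
  have hlog : Real.log (1 + z⁻¹) = Real.log (z + 1) - Real.log z := by
    rw [← Real.log_div (by positivity) hz.ne']
    congr 1
    field_simp
  rw [← hlog]
  refine h.congr_fun fun k => ?_
  rw [pow_succ]
  field_simp

lemma strictAntiOn_add_half_mul_log :
    StrictAntiOn (fun z : ℝ => (z + 1 / 2) * (Real.log (z + 1) - Real.log z)) (Ioi 0) := by
  intro x hx y hy hxy
  have hx : 0 < x := hx
  have hy : 0 < y := hy
  have hlt : 1 / (2 * y + 1) < 1 / (2 * x + 1) :=
    one_div_lt_one_div_of_lt (by positivity) (by linarith)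
  refine hasSum_lt (i := 1) (fun k => ?_) ?_ (hasSum_add_half_mul_log hy)
    (hasSum_add_half_mul_log hx)
  · simp only
    gcongr
  · have : (1 / (2 * y + 1)) ^ (2 * 1) < (1 / (2 * x + 1)) ^ (2 * 1) :=
      pow_lt_pow_left₀ hlt (by positivity) (by norm_num)
    gcongr

/-- The logarithm of `stirlingRatio`, up to the additive constant `log √(2π)`. -/
noncomputable def logStirlingRatio (z : ℝ) : ℝ :=
  (z - 1 / 2) * Real.log z - z - Real.log (Real.Gamma z)

lemma log_Gamma_add_one {z : ℝ} (hz : 0 < z) :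
    Real.log (Real.Gamma (z + 1)) = Real.log z + Real.log (Real.Gamma z) := by
  rw [Real.Gamma_add_one hz.ne', Real.log_mul hz.ne' (Real.Gamma_pos_of_pos hz).ne']

lemma stirlingRatio_eq {z : ℝ} (hz : 0 < z) :
    stirlingRatio z = Real.sqrt (2 * Real.pi) * Real.exp (logStirlingRatio z) := by
  have hG := Real.Gamma_pos_of_pos hz
  have hπ := Real.pi_pos
  have hsqrt : Real.sqrt z = Real.exp (Real.log z / 2) := by
    rw [Real.sqrt_eq_rpow, Real.rpow_def_of_pos hz]
    ring_nf
  have hexp : Real.exp (logStirlingRatio z) =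
      Real.exp ((Real.log z - 1) * z) * Real.exp (Real.log z / 2) /
        (Real.exp (Real.log z) * Real.exp (Real.log (Real.Gamma z))) := by
    rw [← Real.exp_add, ← Real.exp_add, ← Real.exp_sub, logStirlingRatio]
    ring_nf
  rw [hexp, Real.exp_log hz, Real.exp_log hG, stirlingRatio, Real.Gamma_add_one hz.ne',
    Real.sqrt_mul (by positivity), hsqrt, Real.rpow_def_of_pos (by positivity),
    Real.log_div hz.ne' (Real.exp_pos 1).ne', Real.log_exp]
  ring

lemma logStirlingRatio_add_one {z : ℝ} (hz : 0 < z) :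
    logStirlingRatio (z + 1) = logStirlingRatio z +
      ((z + 1 / 2) * (Real.log (z + 1) - Real.log z) - 1) := by
  rw [logStirlingRatio, logStirlingRatio, log_Gamma_add_one hz]
  ring

lemma logStirlingRatio_sub_add_one_lt {x y : ℝ} (hx : 0 < x) (hxy : x < y) :
    logStirlingRatio (y + 1) - logStirlingRatio (x + 1) <
      logStirlingRatio y - logStirlingRatio x := by
  have hy := hx.trans hxy
  have h := strictAntiOn_add_half_mul_log hx hy hxy
  simp only at h
  rw [logStirlingRatio_add_one hx, logStirlingRatio_add_one hy]
  linarith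

lemma log_Gamma_sub_le {x y : ℝ} (hx : 0 < x) (hxy : x < y) :
    Real.log (Real.Gamma y) - Real.log (Real.Gamma x) ≤ (y - x) * Real.log y := by
  have hy := hx.trans hxy
  have h := Real.convexOn_log_Gamma.slope_mono_adjacent (mem_Ioi.2 hx)
    (mem_Ioi.2 (by linarith : 0 < y + 1)) hxy (lt_add_one y)
  simp only [Function.comp_apply, log_Gamma_add_one hy, add_sub_cancel_left, add_sub_cancel_right,
    div_one] at h
  rwa [div_le_iff₀ (sub_pos.2 hxy), mul_comm] at h

lemma neg_div_le_logStirlingRatio_sub {x y : ℝ} (hx : 1 / 2 ≤ x) (hxy : x < y) :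
    -((y - x) * (y - x + 1 / 2)) / y ≤ logStirlingRatio y - logStirlingRatio x := by
  have hx0 : 0 < x := by linarith
  have hy := hx0.trans hxy
  have hG := log_Gamma_sub_le hx0 hxy
  have hlog : 1 - x / y ≤ Real.log y - Real.log x := by
    have := Real.one_sub_inv_le_log_of_pos (div_pos hy hx0)
    rwa [inv_div, Real.log_div hy.ne' hx0.ne'] at this
  have hmul := mul_le_mul_of_nonneg_left hlog (sub_nonneg.2 hx)
  have heq : -((y - x) * (y - x + 1 / 2)) / y = (x - 1 / 2) * (1 - x / y) - (y - x) := by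
    field_simp
    ring
  rw [heq, logStirlingRatio, logStirlingRatio]
  linarith

lemma logStirlingRatio_monotoneOn : MonotoneOn logStirlingRatio (Ioi 0) := by
  intro x hx y _ hxy
  have hx : 0 < x := hx
  rcases hxy.eq_or_lt with rfl | hxy
  · exact le_rfl
  have hanti : Antitone fun n : ℕ => logStirlingRatio (y + n) - logStirlingRatio (x + n) := by
    refine antitone_nat_of_succ_le fun n => ?_
    have h := logStirlingRatio_sub_add_one_lt (x := x + n) (y := y + n) (by positivity)
      (by linarith)
    simpa [add_assoc] using h.le
  have hlim : Tendsto (fun n : ℕ => -((y - x) * (y - x + 1 / 2)) / (y + n)) atTop (nhds 0) :=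
    (tendsto_atTop_add_const_left _ y tendsto_natCast_atTop_atTop).const_div_atTop _
  refine sub_nonneg.1 (le_of_tendsto hlim ?_)
  filter_upwards [eventually_ge_atTop 1] with n hn
  have hn' : (1 : ℝ) ≤ n := by exact_mod_cast hn
  have h := neg_div_le_logStirlingRatio_sub (x := x + n) (y := y + n) (by linarith) (by linarith)
  rw [add_sub_add_right_eq_sub] at h
  simpa using h.trans (hanti n.zero_le)

lemma logStirlingRatio_strictMonoOn : StrictMonoOn logStirlingRatio (Ioi 0) := by
  intro x hx y hy hxy
  have hx : 0 < x := hx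
  have hy : 0 < y := hy
  have h := logStirlingRatio_monotoneOn (mem_Ioi.2 (by linarith : 0 < x + 1))
    (mem_Ioi.2 (by linarith : 0 < y + 1)) (by linarith)
  linarith [logStirlingRatio_sub_add_one_lt hx hxy]

theorem stirlingRatio_strictMono : StrictMonoOn stirlingRatio (Set.Ioi 0) := by
  intro x hx y hy hxy
  rw [stirlingRatio_eq hx, stirlingRatio_eq hy]
  have := Real.pi_pos
  exact mul_lt_mul_of_pos_left (Real.exp_lt_exp.2 (logStirlingRatio_strictMonoOn hx hy hxy))
    (by positivity)
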